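/- Let A be an atomic weakly associative relation algebra. Then the system (B(A), T_κ, E_{κλ})_{κ,λ<3} built from A is a 3-dimensional suitable structure; i.e., each T_κ is an equivalence relation on B(A), E_{κκ} = B(A), E_{κλ} = T*_μ(E_{κμ} ∩ E_{μλ}) whenever μ ∉ {κ,λ}, and T_κ ∩ (E_{κλ}×E_{κλ}) is contained in the identity relation whenever κ ≠ λ. -/

import Mathlib

universe u

/-- A weakly associative relation algebra: a Boolean algebra equipped with
relative multiplication `comp`, converse `conv`, and identity `one'`
satisfying the WA axioms. -/
structure WA (A : Type*) [BooleanAlgebra A] where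
  comp : A → A → A
  conv : A → A
  one' : A
  wassoc : ∀ x : A, comp (comp (x ⊓ one') ⊤) ⊤ = comp (x ⊓ one') ⊤
  rdist : ∀ x y z : A, comp (x ⊔ y) z = comp x z ⊔ comp y z
  comp_one' : ∀ x : A, comp x one' = x
  conv_conv : ∀ x : A, conv (conv x) = x
  conv_sup : ∀ x y : A, conv (x ⊔ y) = conv x ⊔ conv y
  conv_comp : ∀ x y : A, conv (comp x y) = comp (conv y) (conv x)
  tarski : ∀ x y : A, comp (conv x) (comp x y)ᶜ ≤ yᶜ

variable {A : Type u}

/-- The base set of the suitable structure of an atomic WA: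
triples of atoms `s` with `s 1 ≤ s 2 ; s 0`. -/
def BAset [BooleanAlgebra A] (W : WA A) : Set (Fin 3 → A) :=
  {s | (∀ i : Fin 3, IsAtom (s i)) ∧ s 1 ≤ W.comp (s 2) (s 0)}

/-- The relation `T_κ = {(s,t) ∈ B(A)×B(A) : s κ = t κ}`. -/
def Tk [BooleanAlgebra A] (W : WA A) (κ : Fin 3) :
    Set ((Fin 3 → A) × (Fin 3 → A)) :=
  {p | p.1 ∈ BAset W ∧ p.2 ∈ BAset W ∧ p.1 κ = p.2 κ}

/-- The sets `E_{κλ}`: all of `B(A)` when `κ = λ`, and otherwise the triples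
whose entry at the third index `μ ∉ {κ,λ}` is a subidentity atom. -/
def Ee [BooleanAlgebra A] (W : WA A) (κ lam : Fin 3) : Set (Fin 3 → A) :=
  if κ = lam then BAset W
  else {s | s ∈ BAset W ∧ ∀ μ : Fin 3, μ ≠ κ → μ ≠ lam → s μ ≤ W.one'}

/-- The operator `T*_κ(X) = {s ∈ B(A) : s κ = t κ for some t ∈ X}`. -/
def Tstar [BooleanAlgebra A] (W : WA A) (κ : Fin 3) (X : Set (Fin 3 → A)) :
    Set (Fin 3 → A) :=
  {s | s ∈ BAset W ∧ ∃ t ∈ X, s κ = t κ}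

namespace WA

variable [BooleanAlgebra A] (W : WA A)

theorem comp_mono_left {x y : A} (h : x ≤ y) (z : A) : W.comp x z ≤ W.comp y z := by
  rw [← sup_eq_right.2 h, W.rdist]
  exact le_sup_left

theorem conv_mono {x y : A} (h : x ≤ y) : W.conv x ≤ W.conv y := by
  rw [← sup_eq_right.2 h, W.conv_sup]
  exact le_sup_left

/-- Converse as an order automorphism. -/
def convIso : A ≃o A where
  toFun := W.conv
  invFun := W.conv
  left_inv := W.conv_conv
  right_inv := W.conv_conv
  map_rel_iff' {x y} :=
    ⟨fun h => by simpa [W.conv_conv] using W.conv_mono h, fun h => W.conv_mono h⟩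

theorem isAtom_conv {a : A} (ha : IsAtom a) : IsAtom (W.conv a) :=
  (W.convIso.isAtom_iff a).2 ha

theorem comp_mono_right (z : A) {x y : A} (h : x ≤ y) : W.comp z x ≤ W.comp z y := by
  have := W.conv_mono (W.comp_mono_left (W.conv_mono h) (W.conv z))
  simpa only [W.conv_comp, W.conv_conv] using this

theorem comp_mono {x y z w : A} (h : x ≤ y) (h' : z ≤ w) : W.comp x z ≤ W.comp y w :=
  (W.comp_mono_left h z).trans (W.comp_mono_right y h')

theorem conv_one' : W.conv W.one' = W.one' := by
  have h := W.conv_comp (W.conv W.one') W.one'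
  rw [W.comp_one', W.conv_conv, W.comp_one'] at h
  exact h.symm

theorem one'_comp (x : A) : W.comp W.one' x = x := by
  have h := W.conv_comp (W.conv x) W.one'
  rw [W.comp_one', W.conv_conv, W.conv_one'] at h
  exact h.symm

theorem comp_le_left (x : A) {e : A} (he : e ≤ W.one') : W.comp x e ≤ x :=
  (W.comp_mono_right x he).trans (W.comp_one' x).le

theorem comp_le_right (x : A) {e : A} (he : e ≤ W.one') : W.comp e x ≤ x :=
  (W.comp_mono_left he x).trans (W.one'_comp x).le

theorem disjoint_conv_comp {x y z : A} (h : Disjoint z (W.comp x y)) :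
    Disjoint y (W.comp (W.conv x) z) :=
  (le_compl_iff_disjoint_left.1
    ((W.comp_mono_right _ (le_compl_iff_disjoint_right.2 h)).trans (W.tarski x y)))

theorem le_conv_comp {x y z : A} (hz : IsAtom z) (hy : IsAtom y) (h : z ≤ W.comp x y) :
    y ≤ W.comp (W.conv x) z := by
  by_contra hn
  have hd := W.disjoint_conv_comp (hy.not_le_iff_disjoint.1 hn)
  rw [W.conv_conv] at hd
  exact hz.not_le_iff_disjoint.2 hd h

theorem conv_eq_self {e : A} (he : IsAtom e) (h1 : e ≤ W.one') (h : e ≤ W.comp e e) :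
    W.conv e = e := by
  have h2 := (W.le_conv_comp he he h).trans (W.comp_le_left _ h1)
  exact (((W.isAtom_conv he).le_iff_eq he.1).1 h2).symm

/-- Every atom of an atomic algebra has a right unit among the atoms below the identity. -/
theorem exists_right_unit (hatomic : ∀ x : A, x ≠ ⊥ → ∃ a : A, IsAtom a ∧ a ≤ x) {a : A}
    (ha : IsAtom a) : ∃ e, IsAtom e ∧ e ≤ W.one' ∧ a ≤ W.comp a e := by
  have hd : ¬ Disjoint W.one' (W.comp (W.conv a) a) := fun h => by
    have h := W.disjoint_conv_comp h
    rw [W.conv_conv, W.comp_one', disjoint_self] at h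
    exact ha.1 h
  obtain ⟨e, he, hle⟩ := hatomic _ (fun h => hd (disjoint_iff.2 h))
  refine ⟨e, he, hle.trans inf_le_left, ?_⟩
  simpa [W.conv_conv] using W.le_conv_comp he ha (hle.trans inf_le_right)

theorem le_comp_self (hatomic : ∀ x : A, x ≠ ⊥ → ∃ a : A, IsAtom a ∧ a ≤ x) {e : A}
    (he : IsAtom e) (h1 : e ≤ W.one') : e ≤ W.comp e e := by
  obtain ⟨f, hf, hf1, h⟩ := W.exists_right_unit hatomic he
  have hef : e = f := (hf.le_iff_eq he.1).1 (h.trans (W.comp_le_right f h1))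
  rwa [← hef] at h

theorem conv_subidentity (hatomic : ∀ x : A, x ≠ ⊥ → ∃ a : A, IsAtom a ∧ a ≤ x) {e : A}
    (he : IsAtom e) (h1 : e ≤ W.one') : W.conv e = e :=
  W.conv_eq_self he h1 (W.le_comp_self hatomic he h1)

theorem conv_le_comp_of_le_comp
    (hatomic : ∀ x : A, x ≠ ⊥ → ∃ a : A, IsAtom a ∧ a ≤ x) {a e : A}
    (he : IsAtom e) (h1 : e ≤ W.one') (h : a ≤ W.comp a e) :
    W.conv a ≤ W.comp e (W.conv a) := by
  simpa only [W.conv_comp, W.conv_subidentity hatomic he h1] using W.conv_mono h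

theorem conv_le_comp_of_le_comp'
    (hatomic : ∀ x : A, x ≠ ⊥ → ∃ a : A, IsAtom a ∧ a ≤ x) {a e : A}
    (he : IsAtom e) (h1 : e ≤ W.one') (h : a ≤ W.comp e a) :
    W.conv a ≤ W.comp (W.conv a) e := by
  simpa only [W.conv_comp, W.conv_subidentity hatomic he h1] using W.conv_mono h

theorem exists_left_unit (hatomic : ∀ x : A, x ≠ ⊥ → ∃ a : A, IsAtom a ∧ a ≤ x) {a : A}
    (ha : IsAtom a) : ∃ e, IsAtom e ∧ e ≤ W.one' ∧ a ≤ W.comp e a := by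
  obtain ⟨e, he, h1, h⟩ := W.exists_right_unit hatomic (W.isAtom_conv ha)
  refine ⟨e, he, h1, ?_⟩
  simpa only [W.conv_conv] using W.conv_le_comp_of_le_comp hatomic he h1 h

/-- The right unit of an atom is unique; this is where weak associativity is used. -/
theorem right_unit_unique (hatomic : ∀ x : A, x ≠ ⊥ → ∃ a : A, IsAtom a ∧ a ≤ x)
    {a e f : A} (ha : IsAtom a) (he : IsAtom e) (he1 : e ≤ W.one') (hf : IsAtom f)
    (hf1 : f ≤ W.one') (hae : a ≤ W.comp a e) (haf : a ≤ W.comp a f) : e = f := by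
  have h2 : f ≤ W.comp e ⊤ := by
    have hw := W.wassoc e
    rw [inf_eq_left.2 he1] at hw
    refine (W.le_conv_comp ha hf haf).trans (le_trans (W.comp_mono ?_ le_top) hw.le)
    exact (W.conv_le_comp_of_le_comp hatomic he he1 hae).trans (W.comp_mono_right e le_top)
  by_contra hne
  have hd : W.comp e f ≤ ⊥ :=
    he.disjoint_of_ne hf hne (W.comp_le_left e hf1) (W.comp_le_right f he1)
  have h3 : Disjoint f (W.comp e ⊤) := by
    rw [← W.conv_subidentity hatomic he he1]
    refine W.disjoint_conv_comp ?_
    rw [le_bot_iff.1 hd]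
    exact disjoint_bot_right
  exact hf.not_le_iff_disjoint.2 h3 h2

theorem left_unit_unique (hatomic : ∀ x : A, x ≠ ⊥ → ∃ a : A, IsAtom a ∧ a ≤ x)
    {a e f : A} (ha : IsAtom a) (he : IsAtom e) (he1 : e ≤ W.one') (hf : IsAtom f)
    (hf1 : f ≤ W.one') (hae : a ≤ W.comp e a) (haf : a ≤ W.comp f a) : e = f :=
  W.right_unit_unique hatomic (W.isAtom_conv ha) he he1 hf hf1
    (W.conv_le_comp_of_le_comp' hatomic he he1 hae)
    (W.conv_le_comp_of_le_comp' hatomic hf hf1 haf)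

end WA

section BAset

variable [BooleanAlgebra A] {W : WA A} {s : Fin 3 → A}

theorem mk_mem_BAset {a b c : A} (ha : IsAtom a) (hb : IsAtom b) (hc : IsAtom c)
    (h : b ≤ W.comp c a) : ![a, b, c] ∈ BAset W :=
  ⟨fun i => by fin_cases i <;> assumption, h⟩

theorem BAset_one_eq_two (hs : s ∈ BAset W) (h : s 0 ≤ W.one') : s 1 = s 2 :=
  ((hs.1 2).le_iff_eq (hs.1 1).1).1 (hs.2.trans (W.comp_le_left _ h))

theorem BAset_one_eq_zero (hs : s ∈ BAset W) (h : s 2 ≤ W.one') : s 1 = s 0 :=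
  ((hs.1 0).le_iff_eq (hs.1 1).1).1 (hs.2.trans (W.comp_le_right _ h))

theorem BAset_zero_eq_conv_two (hs : s ∈ BAset W) (h : s 1 ≤ W.one') : s 0 = W.conv (s 2) :=
  ((W.isAtom_conv (hs.1 2)).le_iff_eq (hs.1 0).1).1
    ((W.le_conv_comp (hs.1 1) (hs.1 0) hs.2).trans (W.comp_le_left _ h))

theorem BAset_le_one' (hs : s ∈ BAset W) {i j k : Fin 3} (hij : i ≠ j) (hik : i ≠ k)
    (hjk : j ≠ k) (hj : s j ≤ W.one') (hk : s k ≤ W.one') : s i ≤ W.one' := by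
  have h0 := BAset_one_eq_two hs
  have h2 := BAset_one_eq_zero hs
  fin_cases i <;> fin_cases j <;> fin_cases k <;> simp_all

/-- Every atom occurs in a triple at any position, with a subidentity atom at any other position. -/
theorem exists_mem_BAset (W : WA A) (hatomic : ∀ x : A, x ≠ ⊥ → ∃ a : A, IsAtom a ∧ a ≤ x)
    {a : A} (ha : IsAtom a) {i j : Fin 3} (hij : i ≠ j) :
    ∃ t ∈ BAset W, a = t i ∧ t j ≤ W.one' := by
  obtain ⟨e, he, he1, hae⟩ := W.exists_right_unit hatomic ha
  obtain ⟨f, hf, hf1, haf⟩ := W.exists_left_unit hatomic ha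
  have hc := W.isAtom_conv ha
  have hr : ![e, a, a] ∈ BAset W := mk_mem_BAset he ha ha hae
  have hl : ![a, a, f] ∈ BAset W := mk_mem_BAset ha ha hf haf
  have h0 : ![a, e, W.conv a] ∈ BAset W := mk_mem_BAset ha he hc (W.le_conv_comp ha he hae)
  have h2 : ![W.conv a, f, a] ∈ BAset W := mk_mem_BAset hc hf ha (by
    simpa only [W.conv_conv] using W.le_conv_comp hc hf
      (W.conv_le_comp_of_le_comp' hatomic hf hf1 haf))
  fin_cases i <;> fin_cases j
  · exact absurd rfl hij
  · exact ⟨_, h0, rfl, he1⟩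
  · exact ⟨_, hl, rfl, hf1⟩
  · exact ⟨_, hr, rfl, he1⟩
  · exact absurd rfl hij
  · exact ⟨_, hl, rfl, hf1⟩
  · exact ⟨_, hr, rfl, he1⟩
  · exact ⟨_, h2, rfl, hf1⟩
  · exact absurd rfl hij

/-- A triple is determined by one entry and the position of another, subidentity, entry. -/
theorem BAset_ext (hatomic : ∀ x : A, x ≠ ⊥ → ∃ a : A, IsAtom a ∧ a ≤ x) {t : Fin 3 → A}
    (hs : s ∈ BAset W) (ht : t ∈ BAset W) {i j : Fin 3} (hij : i ≠ j) (h : s i = t i)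
    (hsj : s j ≤ W.one') (htj : t j ≤ W.one') : s = t := by
  have key : s 0 = t 0 ∧ s 1 = t 1 ∧ s 2 = t 2 := by
    have hj : j = 0 ∨ j = 1 ∨ j = 2 := by fin_cases j <;> simp
    rcases hj with rfl | rfl | rfl
    · have es := BAset_one_eq_two hs hsj
      have et := BAset_one_eq_two ht htj
      have h1 : s 1 = t 1 := by fin_cases i <;> simp_all
      have hs2 := hs.2
      have ht2 := ht.2
      rw [← es] at hs2
      rw [← et, ← h1] at ht2
      exact ⟨W.right_unit_unique hatomic (hs.1 1) (hs.1 0) hsj (ht.1 0) htj hs2 ht2, h1,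
        es.symm.trans (h1.trans et)⟩
    · have es := BAset_zero_eq_conv_two hs hsj
      have et := BAset_zero_eq_conv_two ht htj
      have h0 : s 0 = t 0 := by fin_cases i <;> simp_all
      have hs2 := W.le_conv_comp (hs.1 1) (hs.1 0) hs.2
      have ht2 := W.le_conv_comp (ht.1 1) (ht.1 0) ht.2
      rw [← es] at hs2
      rw [← et, ← h0] at ht2
      refine ⟨h0, W.right_unit_unique hatomic (hs.1 0) (hs.1 1) hsj (ht.1 1) htj hs2 ht2, ?_⟩
      rw [← W.conv_conv (s 2), ← es, h0, et, W.conv_conv]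
    · have es := BAset_one_eq_zero hs hsj
      have et := BAset_one_eq_zero ht htj
      have h1 : s 1 = t 1 := by fin_cases i <;> simp_all
      have hs2 := hs.2
      have ht2 := ht.2
      rw [← es] at hs2
      rw [← et, ← h1] at ht2
      exact ⟨es.symm.trans (h1.trans et), h1,
        W.left_unit_unique hatomic (hs.1 1) (hs.1 2) hsj (ht.1 2) htj hs2 ht2⟩
  funext k
  fin_cases k
  exacts [key.1, key.2.1, key.2.2]

theorem mem_Ee_iff {i j k : Fin 3} (hij : i ≠ j) (hki : k ≠ i) (hkj : k ≠ j) :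
    s ∈ Ee W i j ↔ s ∈ BAset W ∧ s k ≤ W.one' := by
  simp only [Ee, if_neg hij, Set.mem_ofPred_eq]
  refine and_congr_right fun _ => ⟨fun h => h k hki hkj, fun h m hmi hmj => ?_⟩
  obtain rfl : m = k := by omega
  exact h

end BAset

/-- The system `(B(A), T_κ, E_{κλ})` built from an atomic WA is a
3-dimensional suitable structure. -/
theorem stmt_7 [BooleanAlgebra A] (W : WA A)
    (hatomic : ∀ x : A, x ≠ ⊥ → ∃ a : A, IsAtom a ∧ a ≤ x) :
    (∀ κ : Fin 3, ∀ s ∈ BAset W, (s, s) ∈ Tk W κ) ∧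
    (∀ κ : Fin 3, ∀ s t : Fin 3 → A, (s, t) ∈ Tk W κ → (t, s) ∈ Tk W κ) ∧
    (∀ κ : Fin 3, ∀ s t r : Fin 3 → A,
      (s, t) ∈ Tk W κ → (t, r) ∈ Tk W κ → (s, r) ∈ Tk W κ) ∧
    (∀ κ : Fin 3, Ee W κ κ = BAset W) ∧
    (∀ κ lam μ : Fin 3, μ ≠ κ → μ ≠ lam →
      Ee W κ lam = Tstar W μ (Ee W κ μ ∩ Ee W μ lam)) ∧
    (∀ κ lam : Fin 3, κ ≠ lam → ∀ s t : Fin 3 → A,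
      (s, t) ∈ Tk W κ → s ∈ Ee W κ lam → t ∈ Ee W κ lam → s = t) := by
  refine ⟨fun κ s hs => ⟨hs, hs, rfl⟩, fun κ s t h => ⟨h.2.1, h.1, h.2.2.symm⟩,
    fun κ s t r h h' => ⟨h.1, h'.2.1, h.2.2.trans h'.2.2⟩, fun κ => if_pos rfl, ?_, ?_⟩
  · intro κ lam μ hκ hlam
    ext s
    by_cases hkl : κ = lam
    · subst hkl
      obtain ⟨ν, hνκ, hνμ⟩ : ∃ ν : Fin 3, ν ≠ κ ∧ ν ≠ μ := by
        revert κ μ; decide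
      rw [Ee, if_pos rfl]
      refine ⟨fun hs => ⟨hs, ?_⟩, fun hs => hs.1⟩
      obtain ⟨t, ht, h, h1⟩ := exists_mem_BAset W hatomic (hs.1 μ) hνμ.symm
      exact ⟨t, ⟨(mem_Ee_iff hκ.symm hνκ hνμ).2 ⟨ht, h1⟩,
        (mem_Ee_iff hκ hνμ hνκ).2 ⟨ht, h1⟩⟩, h⟩
    · rw [mem_Ee_iff hkl hκ hlam]
      refine and_congr_right fun hs => ⟨fun h => ?_, ?_⟩
      · have he := hs.1 μ
        have ht := mk_mem_BAset he he he (W.le_comp_self hatomic he h)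
        have hc : ∀ k, ![s μ, s μ, s μ] k = s μ := fun k => by fin_cases k <;> rfl
        exact ⟨_, ⟨(mem_Ee_iff hκ.symm (Ne.symm hkl) hlam.symm).2 ⟨ht, (hc _).trans_le h⟩,
          (mem_Ee_iff hlam hκ.symm hkl).2 ⟨ht, (hc _).trans_le h⟩⟩, (hc μ).symm⟩
      · rintro ⟨t, ⟨h1, h2⟩, h⟩
        rw [mem_Ee_iff hκ.symm (Ne.symm hkl) hlam.symm] at h1
        rw [mem_Ee_iff hlam hκ.symm hkl] at h2
        rw [h]
        exact BAset_le_one' h1.1 hκ hlam hkl h2.2 h1.2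
  · intro κ lam hkl s t hT hs ht
    obtain ⟨μ, hμκ, hμl⟩ : ∃ μ : Fin 3, μ ≠ κ ∧ μ ≠ lam := by
      clear hs ht hT
      revert κ lam; decide
    rw [mem_Ee_iff hkl hμκ hμl] at hs ht
    exact BAset_ext hatomic hs.1 ht.1 hμκ.symm hT.2.2 hs.2 ht.2
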